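/- Let H(x,p) = K(p) depend only on p, where K : ℝⁿ → ℝ is continuous, bounded below, coercive (K(p) → +∞ as |p| → ∞), and locally Lipschitz in the sense of (H3c). For each k ∈ ℕ let u_k be the unique Lipschitz state-constraint viscosity solution of u_k(x) + K(Du_k(x)) = 0 on B(0,k), and note that the constant function u ≡ −K(0) is the unique bounded viscosity solution of u + K(Du) = 0 in ℝⁿ. Then there exists a constant C > 0 depending only on K such that 0 ≤ u_k(x) − u(x) ≤ C e^{(|x| − k)/C} for every k and every x in the closure of B(0,k); in particular, for every R > 0, 0 ≤ u_k(x) − u(x) ≤ (C e^{R/C}) e^{−k/C} for all |x| ≤ R and k ≥ R. -/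

import Mathlib

open Metric Set MeasureTheory Filter
open scoped Topology NNReal RealInnerProductSpace

noncomputable section

abbrev Euc (n : ℕ) := EuclideanSpace ℝ (Fin n)

/-- `v` is a viscosity subsolution of `v + H(x, Dv) = 0` in the open set `Ω`. -/
def IsViscositySubsolutionIn {n : ℕ} (Ω : Set (Euc n)) (H : Euc n → Euc n → ℝ)
    (v : Euc n → ℝ) : Prop :=
  ∀ x ∈ Ω, ∀ φ : Euc n → ℝ, ContDiff ℝ 1 φ →
    IsLocalMaxOn (fun y => v y - φ y) Ω x → v x + H x (gradient φ x) ≤ 0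

/-- `v` is a viscosity supersolution of `v + H(x, Dv) = 0` on the closure of `Ω`. -/
def IsViscositySupersolutionOn {n : ℕ} (Ω : Set (Euc n)) (H : Euc n → Euc n → ℝ)
    (v : Euc n → ℝ) : Prop :=
  ∀ x ∈ closure Ω, ∀ φ : Euc n → ℝ, ContDiff ℝ 1 φ →
    IsLocalMinOn (fun y => v y - φ y) (closure Ω) x → 0 ≤ v x + H x (gradient φ x)

/-- `v` is a state-constraint viscosity solution on `Ω`. -/
def IsStateConstraintSolution {n : ℕ} (Ω : Set (Euc n)) (H : Euc n → Euc n → ℝ)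
    (v : Euc n → ℝ) : Prop :=
  ContinuousOn v (closure Ω) ∧ IsViscositySubsolutionIn Ω H v ∧
    IsViscositySupersolutionOn Ω H v

lemma grad_bound {n : ℕ} (A k C : ℝ) (hA : 0 ≤ A) (hC : 0 < C) (x : Euc n) :
    ContDiff ℝ 1 (fun y : Euc n => A * Real.exp ((Real.sqrt (1 + ‖y‖ ^ 2) - k) / C)) ∧
    ‖gradient (fun y : Euc n => A * Real.exp ((Real.sqrt (1 + ‖y‖ ^ 2) - k) / C)) x‖ ≤
      (A * Real.exp ((Real.sqrt (1 + ‖x‖ ^ 2) - k) / C)) / C := by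
  have hs : ContDiff ℝ 1 (fun y : Euc n => Real.sqrt (1 + ‖y‖ ^ 2)) := by
    apply ContDiff.sqrt
    · exact contDiff_const.add (contDiff_norm_sq ℝ)
    · intro y; positivity
  refine ⟨contDiff_const.mul (((hs.sub contDiff_const).div_const C).exp), ?_⟩
  have hlip : LipschitzWith 1 (fun y : Euc n => Real.sqrt (1 + ‖y‖ ^ 2)) := by
    apply LipschitzWith.of_le_add
    intro a b
    rw [Real.sqrt_le_left (by positivity)]
    have h1 : ‖a‖ ≤ ‖b‖ + dist a b := by
      rw [dist_eq_norm]; exact norm_le_norm_add_norm_sub' a b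
    have h2 := Real.sq_sqrt (show 0 ≤ 1 + ‖b‖ ^ 2 by positivity)
    have h3 : ‖b‖ ≤ Real.sqrt (1 + ‖b‖ ^ 2) := Real.le_sqrt_of_sq_le (by linarith)
    have h4 : 0 ≤ dist a b := dist_nonneg
    nlinarith [norm_nonneg a, norm_nonneg b, mul_le_mul_of_nonneg_right h3 h4]
  have hd : DifferentiableAt ℝ (fun y : Euc n => Real.sqrt (1 + ‖y‖ ^ 2)) x :=
    (hs.differentiable one_ne_zero) x
  have h1 : ‖fderiv ℝ (fun y : Euc n => Real.sqrt (1 + ‖y‖ ^ 2)) x‖ ≤ 1 := by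
    simpa using norm_fderiv_le_of_lipschitz ℝ hlip (x₀ := x)
  have hD := ((((hd.hasFDerivAt).sub_const k).mul_const C⁻¹).exp).const_mul A
  have hgr : ‖gradient (fun y : Euc n => A * Real.exp ((Real.sqrt (1 + ‖y‖ ^ 2) - k) / C)) x‖
      = ‖fderiv ℝ (fun y : Euc n => A * Real.exp ((Real.sqrt (1 + ‖y‖ ^ 2) - k) / C)) x‖ := by
    simp only [gradient, LinearIsometryEquiv.norm_map]
  rw [hgr]
  simp only [div_eq_mul_inv]
  rw [hD.fderiv, norm_smul, norm_smul, norm_smul, Real.norm_of_nonneg hA, Real.norm_of_nonneg (Real.exp_pos _).le,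
    Real.norm_of_nonneg (inv_pos.2 hC).le]
  have : 0 ≤ A * Real.exp ((Real.sqrt (1 + ‖x‖ ^ 2) - k) * C⁻¹) * C⁻¹ := by positivity
  calc _ = A * Real.exp ((Real.sqrt (1 + ‖x‖ ^ 2) - k) * C⁻¹) * C⁻¹ *
        ‖fderiv ℝ (fun y : Euc n => Real.sqrt (1 + ‖y‖ ^ 2)) x‖ := by ring
    _ ≤ _ := mul_le_of_le_one_right this h1

lemma upper_bound {n : ℕ} (K : Euc n → ℝ) (m : ℝ) (hm : ∀ p, m ≤ K p) (k : ℝ) (hk : 0 < k)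
    (u : Euc n → ℝ) (Lip : ℝ≥0)
    (hc : ContinuousOn u (closedBall 0 k))
    (hsub : IsViscositySubsolutionIn (ball (0 : Euc n) k) (fun _ p => K p) u)
    (hL : LipschitzOnWith Lip u (closedBall 0 k)) (x : Euc n) (hx : x ∈ closedBall (0 : Euc n) k) :
    u x ≤ -m := by
  have key : ∀ x ∈ ball (0 : Euc n) k, u x ≤ -m := by
    intro x hx
    have hxk : 0 < k - ‖x‖ := by simpa using hx
    set N : ℝ := (Lip + 1) / (k - ‖x‖) with hN
    have hNpos : 0 < N := by positivity
    have hφ : ContDiff ℝ 1 (fun y : Euc n => N * ‖y - x‖ ^ 2) :=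
      contDiff_const.mul ((contDiff_id.sub contDiff_const).norm_sq ℝ)
    obtain ⟨y, hy, hmax⟩ := (isCompact_closedBall (0 : Euc n) k).exists_isMaxOn
      ⟨x, ball_subset_closedBall hx⟩ (hc.sub hφ.continuous.continuousOn)
    have h1 := hmax (ball_subset_closedBall hx)
    simp at h1
    have h2 := hL.dist_le_mul y hy x (ball_subset_closedBall hx)
    rw [Real.dist_eq, dist_eq_norm] at h2
    have h3 := (abs_le.1 h2).2
    have hd : ‖y - x‖ < k - ‖x‖ := by
      by_contra hcon
      push Not at hcon
      have : N * (k - ‖x‖) = Lip + 1 := by rw [hN]; field_simp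
      nlinarith [mul_le_mul_of_nonneg_left hcon hNpos.le, norm_nonneg (y - x)]
    have hyb : y ∈ ball (0 : Euc n) k := by
      have := norm_le_norm_add_norm_sub' y x
      simp; linarith
    have h4 := hsub y hyb _ hφ ((hmax.on_subset ball_subset_closedBall).localize)
    have h5 := hm (gradient (fun y : Euc n => N * ‖y - x‖ ^ 2) y)
    have : 0 ≤ N * ‖y - x‖ ^ 2 := by positivity
    simp only at h4
    linarith
  rw [← closure_ball _ hk.ne'] at hx hc
  exact ContinuousWithinAt.closure_le hx ((hc x hx).mono subset_closure)
    continuousWithinAt_const key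

lemma main_bound {n : ℕ} (K : Euc n → ℝ) (m : ℝ) (hm : ∀ p, m ≤ K p) (k : ℝ) (hk : 0 < k)
    (u : Euc n → ℝ) (Lip : ℝ≥0)
    (hc : ContinuousOn u (closedBall 0 k))
    (hsub : IsViscositySubsolutionIn (ball (0 : Euc n) k) (fun _ p => K p) u)
    (hL : LipschitzOnWith Lip u (closedBall 0 k)) (x : Euc n) (hx : x ∈ closedBall (0 : Euc n) k)
    (M R D C : ℝ) (hM : M = K 0 - m) (hR : M * Real.exp 1 ≤ R) (hC1 : 1 ≤ C) (hCD : D ≤ C)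
    (hD : 0 < D)
    (hMC : M * Real.exp 1 ≤ C)
    (hKD : ∀ p q : Euc n, ‖p‖ ≤ R → ‖q‖ ≤ R → |K p - K q| ≤ D * ‖p - q‖) :
    u x + K 0 ≤ C * Real.exp ((‖x‖ - k) / C) := by
  have hM0 : 0 ≤ M := by have := hm 0; linarith
  have hC0 : 0 < C := by linarith
  have hsq : ∀ y : Euc n, Real.sqrt (1 + ‖y‖ ^ 2) ≤ 1 + ‖y‖ := by
    intro y
    rw [Real.sqrt_le_left (by positivity)]
    nlinarith [norm_nonneg y]
  have hφb : ∀ y : Euc n, M * Real.exp ((Real.sqrt (1 + ‖y‖ ^ 2) - k) / C) ≤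
      (M * Real.exp 1) * Real.exp ((‖y‖ - k) / C) := by
    intro y
    rw [mul_assoc, ← Real.exp_add]
    gcongr
    have : 1 / C ≤ 1 := by rw [div_le_one hC0]; exact hC1
    calc (Real.sqrt (1 + ‖y‖ ^ 2) - k) / C ≤ (1 + ‖y‖ - k) / C := by gcongr; exact hsq y
      _ = 1 / C + (‖y‖ - k) / C := by ring
      _ ≤ _ := by linarith
  have hφ := fun y : Euc n => grad_bound M k C hM0 hC0 y
  obtain ⟨y, hy, hmax⟩ := (isCompact_closedBall (0 : Euc n) k).exists_isMaxOn
      ⟨x, hx⟩ (hc.sub (hφ 0).1.continuous.continuousOn)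
  have hyk : ‖y‖ ≤ k := by simpa using hy
  have hcl : u y + K 0 ≤ M * Real.exp ((Real.sqrt (1 + ‖y‖ ^ 2) - k) / C) := by
    rcases lt_or_eq_of_le hyk with hlt | heq
    · have hyb : y ∈ ball (0 : Euc n) k := by simpa using hlt
      have h4 := hsub y hyb _ (hφ 0).1 ((hmax.on_subset ball_subset_closedBall).localize)
      simp only at h4
      have hg := (hφ y).2
      set g := gradient (fun y : Euc n => M * Real.exp ((Real.sqrt (1 + ‖y‖ ^ 2) - k) / C)) y
      set P := M * Real.exp ((Real.sqrt (1 + ‖y‖ ^ 2) - k) / C) with hP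
      have hP0 : 0 ≤ P := by positivity
      have hPR : P ≤ R := by
        refine (hφb y).trans (le_trans ?_ hR)
        apply mul_le_of_le_one_right (by positivity)
        rw [Real.exp_le_one_iff]
        exact div_nonpos_of_nonpos_of_nonneg (by linarith) hC0.le
      have hgR : ‖g‖ ≤ R := hg.trans ((div_le_self hP0 hC1).trans hPR)
      have h6 := hKD 0 g (by simpa using hP0.trans hPR) hgR
      have h7 := (abs_le.1 h6).2
      rw [zero_sub, norm_neg] at h7
      have h8 : D * ‖g‖ ≤ P := by
        calc D * ‖g‖ ≤ C * (P / C) := by gcongr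
          _ = P := by field_simp
      linarith
    · have h1 := upper_bound K m hm k hk u Lip hc hsub hL y hy
      have h2 : k ≤ Real.sqrt (1 + ‖y‖ ^ 2) := Real.le_sqrt_of_sq_le (by rw [heq]; linarith)
      have h3 : 1 ≤ Real.exp ((Real.sqrt (1 + ‖y‖ ^ 2) - k) / C) :=
        Real.one_le_exp (div_nonneg (by linarith) hC0.le)
      nlinarith
  have h1 := hmax hx
  simp only [mem_setOf_eq, Pi.sub_apply] at h1
  have h2 := hφb x
  have h3 : (M * Real.exp 1) * Real.exp ((‖x‖ - k) / C) ≤ C * Real.exp ((‖x‖ - k) / C) := by gcongr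
  linarith

lemma lower_bound {n : ℕ} (K : Euc n → ℝ) (k : ℝ) (hk : 0 < k)
    (u : Euc n → ℝ)
    (hc : ContinuousOn u (closedBall 0 k))
    (hsup : IsViscositySupersolutionOn (ball (0 : Euc n) k) (fun _ p => K p) u)
    (x : Euc n) (hx : x ∈ closedBall (0 : Euc n) k) :
    0 ≤ u x + K 0 := by
  obtain ⟨y, hy, hmin⟩ := (isCompact_closedBall (0 : Euc n) k).exists_isMinOn ⟨x, hx⟩ hc
  have h1 := hmin hx
  simp only [mem_setOf_eq] at h1
  unfold IsViscositySupersolutionOn at hsup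
  rw [closure_ball _ hk.ne'] at hsup
  have h2 := hsup y hy (fun _ => 0) contDiff_const (by simpa using hmin.localize)
  have h3 : gradient (fun _ : Euc n => (0 : ℝ)) y = 0 := by simp [gradient]
  simp only [h3] at h2
  linarith

/-- Corollary 1.3: optimal exponential rate for Hamiltonians `H(x,p) = K(p)` depending
only on `p`, on `Ω_k = B(0,k)`; here `u ≡ -K(0)` solves the equation in `ℝⁿ`. -/
theorem rate_exponential_Kp {n : ℕ}
    (K : Euc n → ℝ) (hKcont : Continuous K)
    (hKbdd : ∃ m : ℝ, ∀ p : Euc n, m ≤ K p)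
    (hKcoer : ∀ M : ℝ, ∃ R : ℝ, ∀ p : Euc n, R ≤ ‖p‖ → M ≤ K p)
    (hH3c : ∀ R > (0:ℝ), ∃ C > (0:ℝ), ∀ p q : Euc n, ‖p‖ ≤ R → ‖q‖ ≤ R →
      |K p - K q| ≤ C * ‖p - q‖)
    (uk : ℕ → Euc n → ℝ) (Lip : ℝ≥0)
    (huk : ∀ k : ℕ, 1 ≤ k →
      IsStateConstraintSolution (ball (0 : Euc n) (k : ℝ)) (fun _ p => K p) (uk k) ∧
      LipschitzOnWith Lip (uk k) (closure (ball (0 : Euc n) (k : ℝ)))) :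
    ∃ C > (0:ℝ),
      (∀ k : ℕ, 1 ≤ k → ∀ x ∈ closure (ball (0 : Euc n) (k : ℝ)),
        0 ≤ uk k x - (-K 0) ∧ uk k x - (-K 0) ≤ C * Real.exp ((‖x‖ - (k : ℝ)) / C)) ∧
      (∀ R > (0:ℝ), ∀ k : ℕ, R ≤ (k : ℝ) → ∀ x : Euc n, ‖x‖ ≤ R →
        0 ≤ uk k x - (-K 0) ∧ uk k x - (-K 0) ≤ (C * Real.exp (R / C)) * Real.exp (-(k : ℝ) / C)) := by
  obtain ⟨m, hm⟩ := hKbdd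
  have hM0 : 0 ≤ K 0 - m := by linarith [hm 0]
  have hMe : 0 ≤ (K 0 - m) * Real.exp 1 := by positivity
  obtain ⟨D, hD, hKD⟩ := hH3c ((K 0 - m) * Real.exp 1 + 1) (by positivity)
  set C : ℝ := 1 + D + (K 0 - m) * Real.exp 1 with hC
  have hC0 : 0 < C := by positivity
  have main : ∀ k : ℕ, 1 ≤ k → ∀ x ∈ closure (ball (0 : Euc n) (k : ℝ)),
        0 ≤ uk k x - (-K 0) ∧ uk k x - (-K 0) ≤ C * Real.exp ((‖x‖ - (k : ℝ)) / C) := by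
    intro k hk x hx
    obtain ⟨⟨h1, h2, h3⟩, h4⟩ := huk k hk
    have hk0 : (0 : ℝ) < k := by exact_mod_cast hk
    rw [closure_ball _ hk0.ne'] at hx h1 h4
    rw [sub_neg_eq_add]
    exact ⟨lower_bound K k hk0 _ h1 h3 x hx,
      main_bound K m hm k hk0 _ Lip h1 h2 h4 x hx (K 0 - m) _ D C rfl (by linarith)
        (by linarith) (by linarith) hD (by linarith) hKD⟩
  refine ⟨C, hC0, main, ?_⟩
  intro R hR k hRk x hx
  have hk0 : (0 : ℝ) < k := by linarith
  have hk : 1 ≤ k := by exact_mod_cast hk0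
  have hxk : x ∈ closure (ball (0 : Euc n) (k : ℝ)) := by
    rw [closure_ball _ hk0.ne']; simp; linarith
  obtain ⟨h1, h2⟩ := main k hk x hxk
  refine ⟨h1, h2.trans ?_⟩
  rw [mul_assoc, ← Real.exp_add, ← add_div]
  gcongr
  linarith
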